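/- For every integer σ ≥ 1 and every real T > 0, one has lim_{ε→0⁺} ε · ∫_{(−∞,−T]^σ} |t_1 + ⋯ + t_σ|^{−(σ+ε)} dt_1 ⋯ dt_σ = 1/(σ−1)!. -/

import Mathlib

open MeasureTheory Real Filter Set

theorem lintegral_Iic_sub_rpow {a c ε : ℝ} (hac : c < a) (hε : 0 < ε) :
    ∫⁻ x in Iic c, ENNReal.ofReal ((a - x) ^ (-(ε + 1))) =
      ENNReal.ofReal ((a - c) ^ (-ε) / ε) := by
  have hpos : 0 < a - c := sub_pos.2 hac
  have hexp : -(ε + 1) < -1 := by linarith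
  have hpre : (fun x : ℝ => a - x) ⁻¹' Ici (a - c) = Iic c := by
    ext x
    simp
  rw [← hpre, (Measure.measurePreserving_sub_left volume a).setLIntegral_comp_preimage
      (f := fun y : ℝ => ENNReal.ofReal (y ^ (-(ε + 1)))) measurableSet_Ici (by fun_prop),
    setLIntegral_congr Ioi_ae_eq_Ici.symm,
    ← ofReal_integral_eq_lintegral_ofReal (integrableOn_Ioi_rpow_of_lt hexp hpos),
    integral_Ioi_rpow_of_lt hexp hpos]
  · congr 1
    rw [show -(ε + 1) + 1 = -ε by ring, neg_div_neg_eq]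
  · filter_upwards [ae_restrict_mem measurableSet_Ioi] with y hy
    exact rpow_nonneg (hpos.trans hy).le _

theorem lintegral_pi_Iic_sub_sum_rpow (n : ℕ) {a c ε : ℝ} (ha : 0 ≤ a) (hc : c < 0)
    (hε : 0 < ε) :
    ∫⁻ t : Fin n → ℝ, ENNReal.ofReal ((a - ∑ i, t i) ^ (-((n : ℝ) + ε)))
        ∂(Measure.pi fun _ => volume.restrict (Iic c)) =
      ENNReal.ofReal ((a - n * c) ^ (-ε) / ∏ k ∈ Finset.range n, (ε + k)) := by
  induction n generalizing a ε with
  | zero => simp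
  | succ n ih =>
    have hnc : (n : ℝ) * c ≤ 0 := mul_nonpos_of_nonneg_of_nonpos n.cast_nonneg hc.le
    have hmp := (measurePreserving_piFinSuccAbove
      (fun _ : Fin (n + 1) => (volume : Measure ℝ).restrict (Iic c)) 0).symm
    rw [← hmp.lintegral_comp_emb (MeasurableEquiv.measurableEmbedding _), lintegral_prod _ (by fun_prop)]
    calc
      _ = ∫⁻ x in Iic c, ENNReal.ofReal (((a - n * c) - x) ^ (-(ε + 1))) *
            ENNReal.ofReal (∏ k ∈ Finset.range n, (ε + 1 + k))⁻¹ := by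
        refine setLIntegral_congr_fun measurableSet_Iic fun x hx => ?_
        have hx' : x ≤ c := hx
        have h := ih (a := a - x) (ε := ε + 1) (by linarith) (by linarith)
        rw [← ENNReal.ofReal_mul (rpow_nonneg (by linarith) _), ← div_eq_mul_inv,
          sub_right_comm, ← h]
        refine lintegral_congr fun t => ?_
        rw [show -((n + 1 : ℕ) + ε) = -(n + (ε + 1)) by push_cast; ring]
        simp [MeasurableEquiv.piFinSuccAbove, Fin.sum_univ_succ, sub_sub]
      _ = _ := by
        rw [lintegral_mul_const _ (by fun_prop), lintegral_Iic_sub_rpow (by linarith) hε,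
          ← ENNReal.ofReal_mul
            (div_nonneg (rpow_nonneg (by linarith) _) hε.le), Finset.prod_range_succ',
          Nat.cast_zero, add_zero, mul_comm _ ε, ← div_eq_mul_inv, div_div]
        congr 3
        · push_cast
          ring
        · exact Finset.prod_congr rfl fun k _ => by push_cast; ring

theorem integral_abs_sum_rpow_orthant (n : ℕ) {T ε : ℝ} (hT : 0 < T) (hε : 0 < ε) :
    ∫ t in {t : Fin n → ℝ | ∀ i, t i ≤ -T}, |∑ i, t i| ^ (-((n : ℝ) + ε)) =
      (n * T) ^ (-ε) / ∏ k ∈ Finset.range n, (ε + k) := by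
  have hset : {t : Fin n → ℝ | ∀ i, t i ≤ -T} = univ.pi fun _ => Iic (-T) := by
    ext t
    simp [Pi.le_def]
  rw [hset, setIntegral_congr_fun (g := fun t => (0 - ∑ i, t i) ^ (-((n : ℝ) + ε)))
      (MeasurableSet.univ_pi fun _ => measurableSet_Iic), volume_pi, Measure.restrict_pi_pi,
    integral_eq_lintegral_of_nonneg_ae,
    lintegral_pi_Iic_sub_sum_rpow n le_rfl (neg_neg_of_pos hT) hε, ENNReal.toReal_ofReal]
  · simp
  · exact div_nonneg (rpow_nonneg (by simp; positivity) _)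
      (Finset.prod_nonneg fun k _ => by positivity)
  · rw [← Measure.restrict_pi_pi]
    filter_upwards [ae_restrict_mem (MeasurableSet.univ_pi fun _ => measurableSet_Iic)] with t ht
    refine rpow_nonneg (sub_nonneg.2 (Finset.sum_nonpos fun i _ => ?_)) _
    have : t i ≤ -T := ht i (mem_univ i)
    linarith
  · exact Measurable.aestronglyMeasurable (by fun_prop)
  · intro t ht
    have hsum : ∑ i, t i ≤ 0 := Finset.sum_nonpos fun i _ => by
      have : t i ≤ -T := ht i (mem_univ i)
      linarith
    simp only [abs_of_nonpos hsum, zero_sub]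

/-- For every integer `σ ≥ 1` and every real `T > 0`,
`lim_{ε→0⁺} ε · ∫_{(−∞,−T]^σ} |t₁ + ⋯ + t_σ|^{−(σ+ε)} dt = 1/(σ−1)!`. -/
theorem stmt3 (σ : ℕ) (hσ : 1 ≤ σ) (T : ℝ) (hT : 0 < T) :
    Tendsto
      (fun ε : ℝ => ε * ∫ t in {t : Fin σ → ℝ | ∀ i, t i ≤ -T},
        |∑ i, t i| ^ (-((σ : ℝ) + ε)))
      (nhdsWithin 0 (Ioi 0)) (nhds (1 / (Nat.factorial (σ - 1) : ℝ))) := by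
  obtain ⟨m, rfl⟩ := Nat.exists_eq_add_of_le' hσ
  have hbase : ((m + 1 : ℕ) : ℝ) * T ≠ 0 := by positivity
  have hprod : ∏ k ∈ Finset.range m, ((0 : ℝ) + (k + 1 : ℕ)) = (Nat.factorial m : ℝ) := by
    simp only [zero_add]
    exact_mod_cast Finset.prod_range_add_one_eq_factorial m
  have hcont : ContinuousAt (fun ε : ℝ => (((m + 1 : ℕ) : ℝ) * T) ^ (-ε) /
      ∏ k ∈ Finset.range m, (ε + (k + 1 : ℕ))) 0 := by
    refine ContinuousAt.div (continuousAt_const.rpow continuousAt_id.neg (Or.inl hbase)) (by fun_prop) ?_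
    rw [hprod]
    positivity
  have hlim := hcont.tendsto
  rw [hprod, neg_zero, rpow_zero] at hlim
  refine (hlim.mono_left nhdsWithin_le_nhds).congr' ?_
  filter_upwards [self_mem_nhdsWithin] with ε hε
  have hε' : (0 : ℝ) < ε := hε
  rw [integral_abs_sum_rpow_orthant (m + 1) hT hε', Finset.prod_range_succ', Nat.cast_zero,
    add_zero, mul_comm _ ε, ← mul_div_assoc, mul_div_mul_left _ _ hε'.ne']
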